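/- arXiv:1007.5422 — 4 statements merged into one kernel-verified Lean document; each statement's English description precedes it below -/
import Mathlib

section
/- Fix n ≥ 1 and φ ∈ ℝ, and define the single-qubit map E : Matrix (Fin 2) (Fin 2) ℂ → Matrix (Fin 2) (Fin 2) ℂ by E(σ) = (1 − 2^{−n})·σ + 2^{−n}·u(φ) σ u(φ)ᴴ. Then for every k ∈ ℕ and every ρ ∈ Matrix (Fin 2) (Fin 2) ℂ, the k-fold composition satisfies (E^{[k]}(ρ))(0,1) = ((2^n − 1 + e^{−iφ})/2^n)^k · ρ(0,1) and (E^{[k]}(ρ))(i,i) = ρ(i,i) for i ∈ Fin 2. In particular, in the Markovian scenario where a single system qubit undergoes k independent collisions, each described by a pure phase gate of order n+1 with phase φ acting on the system qubit and n fresh bath qubits, the coherence |ρ(0,1)| is multiplied by the factor [ ((2^n−1)/2^n)·√(1 + 2cos φ/(2^n−1) + 1/(2^n−1)²) ]^k = |(2^n − 1 + e^{−iφ})/2^n|^k. -/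
open Matrix

noncomputable section

/-- The single-qubit phase gate `u(φ) = diag(1, e^{iφ})`. -/
def phaseGate (φ : ℝ) : Matrix (Fin 2) (Fin 2) ℂ :=
  Matrix.diagonal fun i => if i = 1 then Complex.exp (Complex.I * (φ : ℂ)) else 1

theorem star_exp_I_mul (φ : ℝ) :
    star (Complex.exp (Complex.I * (φ : ℂ))) = Complex.exp (-(Complex.I * (φ : ℂ))) := by
  rw [Complex.star_def, ← Complex.exp_conj]
  simp

theorem phaseGate_conj_apply_zero_one (φ : ℝ) (σ : Matrix (Fin 2) (Fin 2) ℂ) :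
    (phaseGate φ * σ * (phaseGate φ)ᴴ) 0 1 =
      Complex.exp (-(Complex.I * (φ : ℂ))) * σ 0 1 := by
  rw [phaseGate, diagonal_conjTranspose, mul_diagonal, diagonal_mul, Pi.star_apply,
    if_pos rfl, star_exp_I_mul, if_neg (by decide)]
  ring

theorem phaseGate_conj_apply_diag (φ : ℝ) (σ : Matrix (Fin 2) (Fin 2) ℂ) (i : Fin 2) :
    (phaseGate φ * σ * (phaseGate φ)ᴴ) i i = σ i i := by
  rw [phaseGate, diagonal_conjTranspose, mul_diagonal, diagonal_mul, Pi.star_apply]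
  split_ifs
  · rw [star_exp_I_mul, mul_right_comm, ← Complex.exp_add, add_neg_cancel, Complex.exp_zero,
      one_mul]
  · simp

/-- Markovian scenario: under `k` iterations of the single-qubit map
`E(σ) = (1-2^{-n})σ + 2^{-n} u(φ)σu(φ)ᴴ` the coherence is multiplied by
`((2^n - 1 + e^{-iφ})/2^n)^k` while the populations are unchanged. -/
theorem markovian_coherence_decay
    (n : ℕ) (hn : 1 ≤ n) (φ : ℝ)
    (E : Matrix (Fin 2) (Fin 2) ℂ → Matrix (Fin 2) (Fin 2) ℂ)
    (hE : ∀ σ, E σ = (1 - ((2 : ℂ) ^ n)⁻¹) • σ +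
      ((2 : ℂ) ^ n)⁻¹ • (phaseGate φ * σ * (phaseGate φ)ᴴ)) :
    ∀ (k : ℕ) (ρ : Matrix (Fin 2) (Fin 2) ℂ),
      (E^[k] ρ) 0 1 = (((2 : ℂ) ^ n - 1 + Complex.exp (-(Complex.I * (φ : ℂ)))) / (2 : ℂ) ^ n) ^ k * ρ 0 1
        ∧ ∀ i : Fin 2, (E^[k] ρ) i i = ρ i i := by
  intro k ρ
  induction k with
  | zero => simp
  | succ k ih =>
    obtain ⟨hcoh, hpop⟩ := ih
    rw [Function.iterate_succ_apply', hE]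
    refine ⟨?_, fun i => ?_⟩
    · rw [Matrix.add_apply, Matrix.smul_apply, Matrix.smul_apply, phaseGate_conj_apply_zero_one, hcoh, pow_succ,
        smul_eq_mul, smul_eq_mul]
      have h2 : (2 : ℂ) ^ n ≠ 0 := pow_ne_zero n two_ne_zero
      have hc : ((2 : ℂ) ^ n - 1 + Complex.exp (-(Complex.I * (φ : ℂ)))) / (2 : ℂ) ^ n =
          1 - ((2 : ℂ) ^ n)⁻¹ + ((2 : ℂ) ^ n)⁻¹ * Complex.exp (-(Complex.I * (φ : ℂ))) := by
        field_simp
      rw [hc]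
      ring
    · rw [Matrix.add_apply, Matrix.smul_apply, Matrix.smul_apply, phaseGate_conj_apply_diag, hpop, smul_eq_mul,
        smul_eq_mul]
      ring

end
end

section
/- Fix n ≥ 1 and φ ∈ ℝ. For every ρ ∈ Matrix (Fin 2) (Fin 2) ℂ, the single-qubit map E(ρ) = (1 − 2^{−n})·ρ + 2^{−n}·u(φ) ρ u(φ)ᴴ admits the Pauli-operator decomposition E(ρ) = 2^{−(n+1)}·[ (2^{n+1} − 1 + cos φ)·ρ + (1 − cos φ)·σ_z ρ σ_z + i·sin φ·(ρ σ_z − σ_z ρ) ]. In particular, for n = 2 (a single pure three-qubit phase gate coupling one system qubit to two bath qubits prepared in |+⟩), E(ρ) = (1/8)[(7 + cos φ)ρ + (1 − cos φ)σ_z ρ σ_z + i sin φ (ρσ_z − σ_z ρ)]. -/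
open Matrix

noncomputable section

/-- Pauli-operator decomposition of the single-qubit dephasing map
`E(ρ) = (1-2^{-n})ρ + 2^{-n}u(φ)ρu(φ)ᴴ`:
`E(ρ) = 2^{-(n+1)}[(2^{n+1}-1+cos φ)ρ + (1-cos φ)σ_z ρ σ_z + i sin φ (ρσ_z - σ_z ρ)]`. -/
theorem dephasing_map_pauli_decomposition
    (n : ℕ) (hn : 1 ≤ n) (φ : ℝ)
    (σz : Matrix (Fin 2) (Fin 2) ℂ) (hσz : σz = !![1, 0; 0, -1]) :
    ∀ ρ : Matrix (Fin 2) (Fin 2) ℂ,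
      (1 - ((2 : ℂ) ^ n)⁻¹) • ρ + ((2 : ℂ) ^ n)⁻¹ • (phaseGate φ * ρ * (phaseGate φ)ᴴ) =
        ((2 : ℂ) ^ (n + 1))⁻¹ •
          (((2 : ℂ) ^ (n + 1) - 1 + ((Real.cos φ : ℝ) : ℂ)) • ρ +
            (1 - ((Real.cos φ : ℝ) : ℂ)) • (σz * ρ * σz) +
            (Complex.I * ((Real.sin φ : ℝ) : ℂ)) • (ρ * σz - σz * ρ)) := by
  intro ρ
  have hσ : σz = Matrix.diagonal fun i => if i = 1 then -1 else 1 := by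
    rw [hσz]
    ext i j
    fin_cases i <;> fin_cases j <;> simp
  subst hσ
  have hpow : (2 : ℂ) ^ n ≠ 0 := pow_ne_zero n two_ne_zero
  have hexp : Complex.exp (Complex.I * (φ : ℂ)) =
      Complex.cos φ + Complex.I * Complex.sin φ := by
    rw [mul_comm, Complex.exp_mul_I, mul_comm Complex.I]
  have hcos : (starRingEnd ℂ) (Complex.cos φ) = Complex.cos φ := by
    rw [← Complex.cos_conj, Complex.conj_ofReal]
  have hsin : (starRingEnd ℂ) (Complex.sin φ) = Complex.sin φ := by
    rw [← Complex.sin_conj, Complex.conj_ofReal]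
  have hnorm := Complex.sin_sq_add_cos_sq (φ : ℂ)
  have hI := Complex.I_sq
  ext i j
  fin_cases i <;> fin_cases j <;>
    simp [phaseGate, Matrix.diagonal_conjTranspose, Matrix.diagonal_mul,
      Matrix.mul_diagonal, hexp, hcos, hsin, pow_succ] <;>
    field_simp <;> grind

end
end

section
/- Let λ ∈ [0,1] and φ ∈ ℝ. Let |Ψ⟩ = √(1−λ)·|0⟩ + √λ·|1⟩ ∈ ℂ², and let C(φ) be the controlled-phase gate on ℂ² ⊗ ℂ² (bath factor first), i.e., the diagonal 4×4 matrix whose entry at the basis index (1,1) is e^{iφ} and whose other diagonal entries are 1. Then for every σ ∈ Matrix (Fin 2) (Fin 2) ℂ, tracing out the bath factor gives tr_{bath}( C(φ) (|Ψ⟩⟨Ψ| ⊗ σ) C(φ)ᴴ ) = (1−λ)·σ + λ·u(φ) σ u(φ)ᴴ. Hence any single-qubit map of the form (1−2^{m−n})σ + 2^{m−n} u(φ)σu(φ)ᴴ arising from a pure phase gate of arbitrary order can be reinterpreted as the interaction with a single bath qubit prepared in the non-uniform state √α|0⟩+√(1−α)|1⟩ with α = 1 − 2^{m−n}, via a two-qubit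 phase gate. -/
open Matrix
open scoped Kronecker

noncomputable section

/-- Interaction with a single bath qubit prepared in
`√(1-λ)|0⟩ + √λ|1⟩` via a controlled-phase gate realizes the single-qubit map
`σ ↦ (1-λ)σ + λ u(φ)σu(φ)ᴴ`. -/
theorem controlled_phase_nonuniform_bath
    (lam : ℝ) (hlam : lam ∈ Set.Icc (0 : ℝ) 1) (φ : ℝ)
    (Ψ : Fin 2 → ℂ)
    (hΨ : Ψ = fun i => if i = 0 then ((Real.sqrt (1 - lam) : ℝ) : ℂ)
      else ((Real.sqrt lam : ℝ) : ℂ))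
    (C : Matrix (Fin 2 × Fin 2) (Fin 2 × Fin 2) ℂ)
    (hC : C = Matrix.diagonal fun p =>
      if p = (1, 1) then Complex.exp (Complex.I * (φ : ℂ)) else 1) :
    ∀ σ : Matrix (Fin 2) (Fin 2) ℂ,
      (Matrix.of fun (s s' : Fin 2) => ∑ b : Fin 2,
          (C * ((Matrix.of fun i j => Ψ i * (starRingEnd ℂ) (Ψ j)) ⊗ₖ σ) * Cᴴ) (b, s) (b, s'))
        = (((1 - lam : ℝ)) : ℂ) • σ + ((lam : ℝ) : ℂ) • (phaseGate φ * σ * (phaseGate φ)ᴴ) := by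
  obtain ⟨h0, h1⟩ := hlam
  subst hΨ hC
  intro σ
  have hs : ∀ x : ℝ, 0 ≤ x → ((Real.sqrt x : ℝ) : ℂ) * ((Real.sqrt x : ℝ) : ℂ) = (x : ℂ) :=
    fun x hx => by rw [← Complex.ofReal_mul, Real.mul_self_sqrt hx]
  have hs0 := hs (1 - lam) (by linarith)
  have hs1 := hs lam h0
  ext s s'
  fin_cases s <;> fin_cases s' <;>
    simp [phaseGate, diagonal_conjTranspose, mul_diagonal, diagonal_mul, hs0, hs1] <;> ring

end
end

section
/- Work in Matrix (Fin 2 × Fin 2) (Fin 2 × Fin 2) ℂ. Let |Ψ^±⟩ = (1/√2)(|01⟩ ± |10⟩) and for a, b, c, d ∈ ℂ define ρ = a·|00⟩⟨00| + b·|11⟩⟨11| + c·|Ψ^+⟩⟨Ψ^+| + d·|Ψ^−⟩⟨Ψ^−|. Then for every φ ∈ ℝ, (u(φ) ⊗ u(φ)) · ρ · (u(φ) ⊗ u(φ))ᴴ = ρ. That is, all states of this form lie in the decoherence-free subset of every collective dephasing map of the form E(σ) = α σ + β (u(φ)⊗u(φ)) σ (u(φ)⊗u(φ))ᴴ; this subset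 strictly contains the two-qubit Werner states (1−p)/4·𝟙 + p·|Ψ^−⟩⟨Ψ^−|. -/
open Matrix
open scoped Kronecker

noncomputable section

/-- The rank-one projector `|ψ⟩⟨ψ|` on two qubits. -/
def ketbra (ψ : Fin 2 × Fin 2 → ℂ) : Matrix (Fin 2 × Fin 2) (Fin 2 × Fin 2) ℂ :=
  Matrix.of fun p q => ψ p * (starRingEnd ℂ) (ψ q)

/-- Conjugating `|ψ⟩⟨ψ|` by an operator for which `ψ` is an eigenvector of unimodular eigenvalue
leaves it unchanged. -/
theorem mul_ketbra_mul_conjTranspose_of_eigenvector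
    {U : Matrix (Fin 2 × Fin 2) (Fin 2 × Fin 2) ℂ} {ψ : Fin 2 × Fin 2 → ℂ} {z : ℂ}
    (hz : ‖z‖ = 1) (hU : U *ᵥ ψ = z • ψ) : U * ketbra ψ * Uᴴ = ketbra ψ := by
  have hψ : ketbra ψ = vecMulVec ψ (star ψ) := rfl
  have hzz : z * star z = 1 := by
    rw [Complex.star_def, Complex.mul_conj, Complex.normSq_eq_norm_sq, hz]
    norm_num
  rw [hψ, mul_vecMulVec, vecMulVec_mul, ← star_mulVec, hU, star_smul, smul_vecMulVec,
    vecMulVec_smul, smul_smul, hzz, one_smul]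

/-- A vector supported on basis states carrying the same total phase `z` is an eigenvector of
the collective phase gate. -/
theorem phaseGate_kronecker_mulVec_eq_smul {φ : ℝ} {ψ : Fin 2 × Fin 2 → ℂ} {z : ℂ}
    (h : ∀ p, ψ p ≠ 0 → Complex.exp (Complex.I * φ) ^ ((p.1 : ℕ) + (p.2 : ℕ)) = z) :
    (phaseGate φ ⊗ₖ phaseGate φ) *ᵥ ψ = z • ψ := by
  ext p
  rw [phaseGate, diagonal_kronecker_diagonal, mulVec_diagonal, Pi.smul_apply, smul_eq_mul]
  by_cases hp : ψ p = 0
  · simp [hp]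
  · rw [← h p hp]
    obtain ⟨i, j⟩ := p
    fin_cases i <;> fin_cases j <;> simp [pow_two]

/-- If `ψ` is supported on basis states with `n` excitations, then `|ψ⟩⟨ψ|` is invariant under
collective dephasing. -/
theorem collective_dephasing_ketbra (φ : ℝ) {ψ : Fin 2 × Fin 2 → ℂ} (n : ℕ)
    (h : ∀ p, ψ p ≠ 0 → (p.1 : ℕ) + (p.2 : ℕ) = n) :
    (phaseGate φ ⊗ₖ phaseGate φ) * ketbra ψ * (phaseGate φ ⊗ₖ phaseGate φ)ᴴ = ketbra ψ :=
  mul_ketbra_mul_conjTranspose_of_eigenvector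
    (z := Complex.exp (Complex.I * φ) ^ n)
    (by rw [norm_pow, Complex.norm_exp_I_mul_ofReal, one_pow])
    (phaseGate_kronecker_mulVec_eq_smul fun p hp => by rw [h p hp])

/-- Every state of the form
`a|00⟩⟨00| + b|11⟩⟨11| + c|Ψ⁺⟩⟨Ψ⁺| + d|Ψ⁻⟩⟨Ψ⁻|` is invariant under collective
dephasing `(u(φ) ⊗ u(φ)) ρ (u(φ) ⊗ u(φ))ᴴ` for every phase `φ`. -/
theorem collective_dephasing_invariant
    (a b c d : ℂ) (φ : ℝ)
    (e00 e11 ψp ψm : Fin 2 × Fin 2 → ℂ)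
    (he00 : e00 = fun p => if p = (0, 0) then 1 else 0)
    (he11 : e11 = fun p => if p = (1, 1) then 1 else 0)
    (hψp : ψp = fun p =>
      if p = (0, 1) then (((Real.sqrt 2)⁻¹ : ℝ) : ℂ)
      else if p = (1, 0) then (((Real.sqrt 2)⁻¹ : ℝ) : ℂ) else 0)
    (hψm : ψm = fun p =>
      if p = (0, 1) then (((Real.sqrt 2)⁻¹ : ℝ) : ℂ)
      else if p = (1, 0) then -(((Real.sqrt 2)⁻¹ : ℝ) : ℂ) else 0)
    (ρ : Matrix (Fin 2 × Fin 2) (Fin 2 × Fin 2) ℂ)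
    (hρ : ρ = a • ketbra e00 + b • ketbra e11 + c • ketbra ψp + d • ketbra ψm) :
    (phaseGate φ ⊗ₖ phaseGate φ) * ρ * (phaseGate φ ⊗ₖ phaseGate φ)ᴴ = ρ := by
  have h00 := collective_dephasing_ketbra φ (ψ := e00) 0 (by simp [he00])
  have h11 := collective_dephasing_ketbra φ (ψ := e11) 2 (by simp [he11])
  have hp := collective_dephasing_ketbra φ (ψ := ψp) 1 (by simp [hψp])
  have hm := collective_dephasing_ketbra φ (ψ := ψm) 1 (by simp [hψm])
  simp only [hρ, mul_add, add_mul, mul_smul_comm, smul_mul_assoc, h00, h11, hp, hm]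

end
end
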